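/- For all X, Y ∈ 𝔤 one has ∇̃_{X^v}Y^v = (φ(∇²_X Y − ½[X,Y]))^c. -/

import Mathlib

/-- `g` is an inner product (symmetric positive-definite bilinear form) on a real vector space. -/
structure IsInnerProd {L : Type*} [AddCommGroup L] [Module ℝ L] (g : L → L → ℝ) : Prop where
  addLeft : ∀ x y z : L, g (x + y) z = g x z + g y z
  smulLeft : ∀ (a : ℝ) (x y : L), g (a • x) y = a * g x y
  symm : ∀ x y : L, g x y = g y x
  posDef : ∀ x : L, x ≠ 0 → 0 < g x x

/-- The bracket of the tangent Lie algebra `T𝔤 = 𝔤 × 𝔤`: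
`[(X₁,Y₁),(X₂,Y₂)] = ([X₁,X₂], [X₁,Y₂] + [Y₁,X₂])`.
The complete lift of `X` is `(X, 0)` and the vertical lift is `(0, X)`. -/
def tbr {L : Type*} [LieRing L] (A B : L × L) : L × L :=
  (⁅A.1, B.1⁆, ⁅A.1, B.2⁆ + ⁅A.2, B.1⁆)

/-- The lifted inner product `g̃` on `T𝔤 = 𝔤 × 𝔤` determined by
`g̃(X^c,Y^c) = ⟨X,Y⟩₁`, `g̃(X^v,Y^v) = ⟨X,Y⟩₂`, `g̃(X^c,Y^v) = 0`. -/
def tg {L : Type*} (g1 g2 : L → L → ℝ) (A B : L × L) : ℝ :=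
  g1 A.1 B.1 + g2 A.2 B.2

/-- `nab` is the Levi-Civita connection of the metric `g` with respect to the bracket `br`,
i.e. it satisfies the Koszul formula
`2⟨∇_X Y, Z⟩ = ⟨[X,Y],Z⟩ − ⟨[Y,Z],X⟩ + ⟨[Z,X],Y⟩`. -/
def IsLC {V : Type*} [AddCommGroup V] [Module ℝ V] (br : V → V → V)
    (g : V → V → ℝ) (nab : V → V → V) : Prop :=
  ∀ X Y Z : V, 2 * g (nab X Y) Z = g (br X Y) Z - g (br Y Z) X + g (br Z X) Y

/-- The curvature tensor `R(X,Y)Z = ∇_X ∇_Y Z − ∇_Y ∇_X Z − ∇_{[X,Y]} Z`. -/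
def curvOf {V : Type*} [AddCommGroup V] (br nab : V → V → V) (X Y Z : V) : V :=
  nab X (nab Y Z) - nab Y (nab X Z) - nab (br X Y) Z

namespace IsInnerProd

variable {L : Type*} [AddCommGroup L] [Module ℝ L] {g : L → L → ℝ}

lemma zero_left (hg : IsInnerProd g) (z : L) : g 0 z = 0 := by
  simpa using hg.smulLeft 0 0 z

lemma zero_right (hg : IsInnerProd g) (z : L) : g z 0 = 0 := by
  rw [hg.symm, hg.zero_left]

lemma sub_smul_left (hg : IsInnerProd g) (a : ℝ) (x y z : L) :
    g (x - a • y) z = g x z - a * g y z := by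
  rw [sub_eq_add_neg, ← neg_smul, hg.addLeft, hg.smulLeft]
  ring

lemma ext_left (hg : IsInnerProd g) {x y : L} (h : ∀ z, g x z = g y z) : x = y := by
  by_contra hne
  have hpos := hg.posDef (x - y) (sub_ne_zero.mpr hne)
  have hzero := hg.sub_smul_left 1 x y (x - y)
  rw [one_smul, h] at hzero
  linarith

end IsInnerProd

theorem statement5 {L : Type*} [LieRing L] [Module ℝ L] [LieAlgebra ℝ L]
    [FiniteDimensional ℝ L]
    (g1 g2 : L → L → ℝ) (hg1 : IsInnerProd g1) (hg2 : IsInnerProd g2)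
    (nabla1 nabla2 : L → L → L)
    (hn1 : IsLC (fun X Y : L => ⁅X, Y⁆) g1 nabla1)
    (hn2 : IsLC (fun X Y : L => ⁅X, Y⁆) g2 nabla2)
    (tnabla : L × L → L × L → L × L)
    (htn : IsLC tbr (tg g1 g2) tnabla)
    (phi : L →ₗ[ℝ] L)
    (hphi : ∀ X Y : L, g2 X Y = g1 (phi X) Y) :
    ∀ X Y : L, tnabla (0, X) (0, Y) = (phi (nabla2 X Y - ((1 : ℝ) / 2) • ⁅X, Y⁆), (0 : L)) := by
  intro X Y
  refine Prod.ext (hg1.ext_left fun Z => ?_) (hg2.ext_left fun Z => ?_)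
  · have hK := htn (0, X) (0, Y) (Z, 0)
    have hK2 := hn2 X Y Z
    simp only [tg, tbr, zero_lie, lie_zero, add_zero, zero_add, hg1.zero_left,
      hg2.zero_left, hg2.zero_right] at hK
    simp only at hK2
    rw [← hphi, hg2.sub_smul_left]
    linarith
  · have hK := htn (0, X) (0, Y) (0, Z)
    simp only [tg, tbr, zero_lie, lie_zero, add_zero, zero_add, hg1.zero_left,
      hg1.zero_right, hg2.zero_left] at hK
    rw [hg2.zero_left]
    linarith
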